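/- Let k ≥ 1 be an integer and let f: ℝ → ℝ be any bounded measurable function. Then ∫_{[0,1]^{k²}} f(u_1^{(k)} + u_2^{(k−1)} + ⋯ + u_k^{(1)}) · 1_{A_k}(u) du = (1/(k! · G(1+k)²)) · ∫_{[0,1]^k} f(w_1 + ⋯ + w_k) · ∏_{1≤i<j≤k}(w_i − w_j)² dw, where G(1+k) = 1!·2!·⋯·(k−1)! (the Barnes G-function at integer argument), the left-hand integral is over all k×k arrays u = (u_i^{(j)}) ∈ [0,1]^{k²}, and 1_{A_k} is the indicator function of A_k. -/

import Mathlib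

open MeasureTheory

/-- The set `A_k` of `k × k` real arrays whose entries weakly increase along each row
and weakly decrease down each column. -/
def Ak (k : ℕ) : Set (Fin k → Fin k → ℝ) :=
  {u | (∀ i, Monotone (u i)) ∧ ∀ j, Antitone fun i => u i j}


lemma det_diff (n : ℕ) (v : Fin (n+1) → ℝ) :
    (Matrix.of fun i j : Fin n => v i.succ ^ (j.val+1) - v i.castSucc ^ (j.val+1)).det
      = (Matrix.vandermonde v).det := by
  let B : Matrix (Fin (n+1)) (Fin (n+1)) ℝ := Matrix.of fun i j =>
    Fin.cases (v 0 ^ j.val) (fun i' => v i'.succ ^ j.val - v i'.castSucc ^ j.val) i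
  have h : (Matrix.vandermonde v).det = B.det := by
    apply Matrix.det_eq_of_forall_row_eq_smul_add_pred (fun _ => 1)
    · intro j; simp [B]
    · intro i j; simp [B]
  rw [h, Matrix.det_succ_column_zero, Fin.sum_univ_succ]
  simp [B]
  rfl

def DD {n : ℕ} (w : Fin n → ℝ) : ℝ := (Matrix.vandermonde (fun i => - w i)).det

lemma DD_eq {n : ℕ} (w : Fin n → ℝ) : DD w = ∏ i, ∏ j ∈ Finset.Ioi i, (w i - w j) := by
  simp only [DD, Matrix.det_vandermonde]
  refine Finset.prod_congr rfl fun i _ => Finset.prod_congr rfl fun j _ => by ring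

lemma DD_nonneg {n : ℕ} {w : Fin n → ℝ} (hw : Antitone w) : 0 ≤ DD w := by
  rw [DD_eq]
  refine Finset.prod_nonneg fun i _ => Finset.prod_nonneg fun j hj => ?_
  have := hw (Finset.mem_Ioi.1 hj).le
  linarith

lemma continuous_DD {n : ℕ} : Continuous (DD (n := n)) := by
  have : DD (n := n) = fun w => ∏ i, ∏ j ∈ Finset.Ioi i, (w i - w j) := funext DD_eq
  rw [this]; fun_prop

lemma integral_pow_neg (a b : ℝ) (h : a ≤ b) (m : ℕ) :
    ∫ x in Set.Icc a b, (-x)^m = (1/((m:ℝ)+1)) * ((-a)^(m+1) - (-b)^(m+1)) := by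
  rw [integral_Icc_eq_integral_Ioc, ← intervalIntegral.integral_of_le h,
    intervalIntegral.integral_comp_neg (fun x => x^m), integral_pow]
  ring

lemma integral_DD (n : ℕ) (w : Fin (n+1) → ℝ) (hw : Antitone w) :
    ∫ x in Set.univ.pi (fun i : Fin n => Set.Icc (w i.succ) (w i.castSucc)), DD x
      = DD w / n.factorial := by
  have hle : ∀ i : Fin n, w i.succ ≤ w i.castSucc := fun i => hw (Fin.castSucc_lt_succ (i := i)).le
  rw [volume_pi, Measure.restrict_pi_pi]
  simp only [DD, Matrix.det_apply', Matrix.vandermonde_apply]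
  rw [integral_finsetSum]
  · simp only [integral_const_mul]
    have : ∀ σ : Equiv.Perm (Fin n), ∫ (a : Fin n → ℝ), ∏ x, (-a (σ x)) ^ (x:ℕ) ∂Measure.pi (fun i : Fin n => volume.restrict (Set.Icc (w i.succ) (w i.castSucc)))
       = (1 / (n.factorial:ℝ)) * ∏ x, ((-w (σ x).succ)^(x.val+1) - (-w (σ x).castSucc)^(x.val+1)) := by
      intro σ
      have h1 : ∀ a : Fin n → ℝ, ∏ x, (-a (σ x)) ^ (x:ℕ) = ∏ i, (fun (i : Fin n) (t : ℝ) => (-t)^((σ.symm i : Fin n):ℕ)) i (a i) := by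
        intro a
        rw [← Equiv.prod_comp σ (fun i => (fun (i : Fin n) (t : ℝ) => (-t)^((σ.symm i : Fin n):ℕ)) i (a i))]; simp
      rw [integral_congr_ae (Filter.Eventually.of_forall h1)]
      rw [integral_fintype_prod_eq_prod (𝕜 := ℝ) (E := fun _ => ℝ) (fun (i : Fin n) (t : ℝ) => (-t)^((σ.symm i : Fin n):ℕ))]
      simp_rw [integral_pow_neg _ _ (hle _)]
      rw [← Equiv.prod_comp σ, Finset.prod_mul_distrib]
      simp only [Equiv.symm_apply_apply]
      congr 1
      rw [Finset.prod_div_distrib, Finset.prod_const_one, Fin.prod_univ_eq_prod_range (fun i => (i:ℝ)+1), ← Finset.prod_range_add_one_eq_factorial]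
      push_cast; rfl
    simp_rw [this]
    have h2 := det_diff n (fun i => - w i)
    rw [Matrix.det_apply'] at h2
    simp only [Matrix.of_apply] at h2
    have h3 := (Matrix.det_apply' (Matrix.vandermonde (fun i => -w i)))
    simp only [Matrix.vandermonde_apply] at h3
    rw [← h3, ← h2, Finset.sum_div]
    refine Finset.sum_congr rfl fun σ _ => by ring
  · intro σ _
    rw [← Measure.restrict_pi_pi]
    refine ContinuousOn.integrableOn_compact (isCompact_univ_pi fun i => isCompact_Icc) ?_
    fun_prop

lemma mp_reindex {ι κ : Type*} [Fintype ι] [Fintype κ] (e : ι ≃ κ) :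
    MeasurePreserving (fun (g : κ → ℝ) (i : ι) => g (e i)) :=
  (volume_measurePreserving_piCongrLeft (fun _ : κ => ℝ) e).symm

lemma mp_sum {ι ι' κ : Type*} [Fintype ι] [Fintype ι'] [Fintype κ] (e : ι ⊕ ι' ≃ κ) :
    MeasurePreserving (fun (g : κ → ℝ) => ((fun i => g (e (.inl i)), fun i => g (e (.inr i))) : (ι → ℝ) × (ι' → ℝ))) :=
  (volume_measurePreserving_sumPiEquivProdPi (fun _ : ι ⊕ ι' => ℝ)).comp (mp_reindex e)

lemma mp_uncurry {ι κ : Type*} [Fintype ι] [Fintype κ] :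
    MeasurePreserving (fun (u : ι → κ → ℝ) (p : ι × κ) => u p.1 p.2) := by
  refine ⟨by fun_prop, ?_⟩
  refine (Measure.pi_eq fun s hs => ?_).symm
  rw [Measure.map_apply (by fun_prop) (MeasurableSet.univ_pi hs)]
  have : (fun (u : ι → κ → ℝ) (p : ι × κ) => u p.1 p.2) ⁻¹' Set.univ.pi s
      = Set.univ.pi fun i => Set.univ.pi fun j => s (i, j) := by
    ext u; simp [Set.mem_pi]
  rw [this, volume_pi_pi]
  simp_rw [volume_pi_pi]
  rw [Fintype.prod_prod_type]

abbrev Tri (n : ℕ) := {p : Fin n × Fin n // p.1 < p.2}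

def CC : (n : ℕ) → (Fin n → ℝ) → (Tri n → ℝ) → Prop
  | 0, _, _ => True
  | n+1, w, x =>
    (∀ i : Fin n, x ⟨(i.castSucc, i.succ), Fin.castSucc_lt_succ⟩ ∈ Set.Icc (w i.succ) (w i.castSucc)) ∧
    CC n (fun i => x ⟨(i.castSucc, i.succ), Fin.castSucc_lt_succ⟩)
      (fun p => x ⟨(p.1.1.castSucc, p.1.2.succ), Fin.castSucc_lt_succ.trans (Fin.succ_lt_succ_iff.2 p.2)⟩)

lemma CC_meas (n : ℕ) : MeasurableSet {p : (Fin n → ℝ) × (Tri n → ℝ) | CC n p.1 p.2} := by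
  induction n with
  | zero => simp [CC]
  | succ n ih =>
    simp only [CC, Set.ofPred_and, Set.ofPred_forall, Set.mem_Icc]
    refine MeasurableSet.inter (MeasurableSet.iInter fun i => MeasurableSet.inter ?_ ?_) ?_
    · exact measurableSet_le (by fun_prop) (by fun_prop)
    · exact measurableSet_le (by fun_prop) (by fun_prop)
    · exact measurableSet_preimage (f := fun p : (Fin (n+1) → ℝ) × (Tri (n+1) → ℝ) => (((fun i => p.2 ⟨(i.castSucc, i.succ), Fin.castSucc_lt_succ⟩),
      (fun q => p.2 ⟨(q.1.1.castSucc, q.1.2.succ), Fin.castSucc_lt_succ.trans (Fin.succ_lt_succ_iff.2 q.2)⟩)) : (Fin n → ℝ) × (Tri n → ℝ))) (by fun_prop) ih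

noncomputable def triEquiv (n : ℕ) : Fin n ⊕ Tri n ≃ Tri (n+1) :=
  Equiv.ofBijective (Sum.elim (fun i => ⟨(i.castSucc, i.succ), Fin.castSucc_lt_succ⟩)
    (fun p => ⟨(p.1.1.castSucc, p.1.2.succ), Fin.castSucc_lt_succ.trans (Fin.succ_lt_succ_iff.2 p.2)⟩)) (by
    constructor
    · rintro (i | ⟨⟨i,j⟩,h⟩) (i' | ⟨⟨i',j'⟩,h'⟩) hh <;>
        simp [Fin.ext_iff] at hh ⊢ <;> grind
    · rintro ⟨⟨⟨i, hi⟩, ⟨j, hj⟩⟩, h⟩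
      simp only [Fin.mk_lt_mk] at h
      by_cases hij : j = i + 1
      · subst hij
        exact ⟨.inl ⟨i, by omega⟩, by simp⟩
      · refine ⟨.inr ⟨(⟨i, by omega⟩, ⟨j-1, by omega⟩), by simp; omega⟩, ?_⟩
        simp [Fin.ext_iff]; omega)

lemma antitone_of_adj {n : ℕ} {w : Fin n → ℝ} (h : ∀ i j : Fin n, j.val = i.val + 1 → w j ≤ w i) :
    Antitone w := by
  cases n with
  | zero => intro i; exact i.elim0
  | succ n => exact Fin.antitone_iff_succ_le.2 fun i => h _ _ (by simp)

lemma CC_antitone {n : ℕ} {w : Fin n → ℝ} {x : Tri n → ℝ} (h : CC n w x) : Antitone w := by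
  cases n with
  | zero => intro i; exact i.elim0
  | succ n => exact Fin.antitone_iff_succ_le.2 fun i => (h.1 i).1.trans (h.1 i).2

lemma antitone_box {n : ℕ} {w : Fin (n+1) → ℝ} {x : Fin n → ℝ}
   (h : ∀ i, x i ∈ Set.Icc (w i.succ) (w i.castSucc)) : Antitone x := by
  refine antitone_of_adj fun i j hij => (h j).2.trans (le_trans (le_of_eq ?_) (h i).1)
  congr 1; ext; simp [hij]

noncomputable def GG (n : ℕ) : ℝ := ∏ i ∈ Finset.range n, (i.factorial : ℝ)

lemma GG_pos (n : ℕ) : 0 < GG n := Finset.prod_pos fun i _ => by positivity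

lemma CC_vol (n : ℕ) (w : Fin n → ℝ) (hw : Antitone w) :
    volume {x | CC n w x} = ENNReal.ofReal (DD w / GG n) := by
  induction n with
  | zero => simp [CC, DD, GG, volume_pi]
  | succ n ih =>
    have hmb : MeasurableSet (Set.univ.pi (fun i : Fin n => Set.Icc (w i.succ) (w i.castSucc))) :=
      MeasurableSet.univ_pi fun i => measurableSet_Icc
    let S : Set ((Fin n → ℝ) × (Tri n → ℝ)) :=
      {p | p.1 ∈ Set.univ.pi (fun i : Fin n => Set.Icc (w i.succ) (w i.castSucc))} ∩ {p | CC n p.1 p.2}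
    have hS : MeasurableSet S := (measurable_fst hmb).inter (CC_meas n)
    have h1 := (mp_sum (triEquiv n)).measure_preimage hS.nullMeasurableSet
    have h2 : (fun (g : Tri (n+1) → ℝ) => ((fun i => g (triEquiv n (.inl i)), fun i => g (triEquiv n (.inr i))) : (Fin n → ℝ) × (Tri n → ℝ))) ⁻¹' S = {x | CC (n+1) w x} := by
      ext x
      simp only [S, Set.mem_preimage, Set.mem_inter_iff, Set.mem_ofPred_eq, Set.mem_univ_pi, CC]
      rfl
    rw [← h2, h1, Measure.volume_eq_prod, Measure.prod_apply hS]
    have h3 : ∀ a : Fin n → ℝ, volume (Prod.mk a ⁻¹' S) = (Set.univ.pi (fun i : Fin n => Set.Icc (w i.succ) (w i.castSucc))).indicator (fun a => ENNReal.ofReal (DD a / GG n)) a := by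
      intro a
      by_cases ha : a ∈ Set.univ.pi (fun i : Fin n => Set.Icc (w i.succ) (w i.castSucc))
      · rw [Set.indicator_of_mem ha, ← ih a (antitone_box (w := w) (fun i => ha i trivial))]
        congr 1; ext b; simp only [S, Set.mem_preimage, Set.mem_inter_iff, Set.mem_ofPred_eq, ha, true_and]
      · rw [Set.indicator_of_notMem ha]
        have : Prod.mk a ⁻¹' S = ∅ := by
          ext b; simp only [S, Set.mem_preimage, Set.mem_inter_iff, Set.mem_ofPred_eq, ha, false_and, Set.mem_empty_iff_false]
        simp [this]
    simp_rw [h3]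
    rw [lintegral_indicator hmb, ← ofReal_integral_eq_lintegral_ofReal, integral_div, integral_DD n w hw]
    · congr 1
      simp only [GG, Finset.prod_range_succ]
      field_simp
    · refine ContinuousOn.integrableOn_compact (isCompact_univ_pi fun i => isCompact_Icc) ?_
      exact (continuous_DD.div_const _).continuousOn
    · refine (ae_restrict_iff' hmb).2 (Filter.Eventually.of_forall fun a ha => ?_)
      exact div_nonneg (DD_nonneg (antitone_box (w := w) (fun i => ha i trivial))) (GG_pos n).le

lemma CC_iff (n : ℕ) (v : Fin n → Fin n → ℝ) :
    CC n (fun i => v i i) (fun p => v p.1.1 p.1.2) ↔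
      (∀ i j j', i ≤ j → j'.val = j.val + 1 → v i j' ≤ v i j) ∧
      (∀ i i' j, i' ≤ j → i'.val = i.val + 1 → v i' j ≤ v i j) := by
  induction n with
  | zero => simp [CC]
  | succ n ih =>
    have := ih (fun i j => v i.castSucc j.succ)
    simp only [CC]
    rw [this]
    constructor
    · rintro ⟨h1, h2, h3⟩
      constructor
      · intro i j j' hij hj
        by_cases h : i = j
        · subst h
          have := (h1 ⟨i, by omega⟩).2
          convert this using 2 <;> (ext; simp [hj])
        · have hij' : i.val < j.val := by omega
          convert h2 ⟨i, by omega⟩ ⟨j.val-1, by omega⟩ ⟨j.val, by omega⟩ (by simp; omega) (by simp; omega) using 2 <;> (ext; simp) <;> omega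
      · intro i i' j hij hi
        by_cases h : i' = j
        · subst h
          have := (h1 ⟨i, by omega⟩).1
          convert this using 2 <;> (ext; simp [hi])
        · have hij' : i'.val < j.val := by omega
          convert h3 ⟨i, by omega⟩ ⟨i', by omega⟩ ⟨j.val-1, by omega⟩ (by simp; omega) (by simp; omega) using 2 <;> (ext; simp) <;> omega
    · rintro ⟨h1, h2⟩
      refine ⟨fun i => ⟨h2 _ _ _ le_rfl (by simp), h1 _ _ _ le_rfl (by simp)⟩, ?_, ?_⟩
      · intro i j j' hij hj
        exact h1 _ _ _ (by rw [Fin.le_def] at hij ⊢; simp; omega) (by simp; omega)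
      · intro i i' j hij hi
        exact h2 _ _ _ (by rw [Fin.le_def] at hij ⊢; simp; omega) (by simp; omega)

lemma Ak_iff' {k : ℕ} (u : Fin k → Fin k → ℝ) :
    u ∈ Ak k ↔ CC k (fun i => u i (Fin.rev i)) (fun p => u p.1.1 (Fin.rev p.1.2)) ∧
      CC k (fun i => u i (Fin.rev i)) (fun p => u p.1.2 (Fin.rev p.1.1)) := by
  rw [CC_iff k (fun i j => u i (Fin.rev j)), CC_iff k (fun i j => u j (Fin.rev i))]
  constructor
  · rintro ⟨h1, h2⟩
    have h1' : ∀ i j j' : Fin k, j'.val = j.val + 1 → u i (Fin.rev j') ≤ u i (Fin.rev j) := by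
      intro i j j' h
      exact h1 i (Fin.rev_le_rev.2 (by rw [Fin.le_def]; omega))
    have h2' : ∀ i i' j : Fin k, i'.val = i.val + 1 → u i' j ≤ u i j := by
      intro i i' j h
      exact h2 j (show i ≤ i' by rw [Fin.le_def]; omega)
    exact ⟨⟨fun i j j' _ h => h1' _ _ _ h, fun i i' j _ h => h2' _ _ _ h⟩,
      ⟨fun i j j' _ h => h2' _ _ _ h, fun i i' j _ h => h1' _ _ _ h⟩⟩
  · rintro ⟨⟨h1, h2⟩, h3, h4⟩
    constructor
    · intro i
      have : Antitone fun j => u i (Fin.rev j) := by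
        refine antitone_of_adj fun j j' h => ?_
        by_cases hij : i ≤ j
        · exact h1 _ _ _ hij h
        · exact h4 j j' i (by omega) h
      intro a b hab
      simpa using this (Fin.rev_le_rev.2 hab)
    · intro j
      refine antitone_of_adj fun i i' h => ?_
      by_cases hij : i' ≤ j.rev
      · simpa using h2 i i' j.rev hij h
      · simpa using h3 j.rev i i' (by omega) h

lemma Ak_iff {k : ℕ} (u : Fin k → Fin k → ℝ) :
    ((∀ i j, u i j ∈ Set.Icc (0:ℝ) 1) ∧ u ∈ Ak k) ↔ (∀ i, u i (Fin.rev i) ∈ Set.Icc (0:ℝ) 1) ∧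
      CC k (fun i => u i (Fin.rev i)) (fun p => u p.1.1 (Fin.rev p.1.2)) ∧
      CC k (fun i => u i (Fin.rev i)) (fun p => u p.1.2 (Fin.rev p.1.1)) := by
  rw [← Ak_iff']
  refine ⟨fun ⟨h1, h2⟩ => ⟨fun i => h1 _ _, h2⟩, fun ⟨h1, h2⟩ => ⟨fun i j => ?_, h2⟩⟩
  have ha := h2.1
  have hb := h2.2
  have e1 := h1 i
  have e2 := h1 (Fin.rev j)
  rw [Fin.rev_rev] at e2
  rcases le_total i (Fin.rev j) with h | h
  · exact ⟨e2.1.trans (hb j h), (ha i (by simpa using Fin.rev_le_rev.2 h)).trans e1.2⟩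
  · exact ⟨e1.1.trans (ha i (by simpa using Fin.rev_le_rev.2 h)), (hb j h).trans e2.2⟩

noncomputable def sqEquiv (k : ℕ) : Fin k ⊕ (Tri k ⊕ Tri k) ≃ Fin k × Fin k :=
  Equiv.ofBijective (Sum.elim (fun i => (i, Fin.rev i)) (Sum.elim
    (fun p => (p.1.1, Fin.rev p.1.2)) (fun p => (p.1.2, Fin.rev p.1.1)))) (by
    constructor
    · rintro (i | ⟨⟨i,j⟩,h⟩ | ⟨⟨i,j⟩,h⟩) (i' | ⟨⟨i',j'⟩,h'⟩ | ⟨⟨i',j'⟩,h'⟩) hh <;>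
        simp at hh ⊢ <;> grind
    · rintro ⟨i, j⟩
      rcases lt_trichotomy i (Fin.rev j) with h | h | h
      · exact ⟨.inr (.inl ⟨(i, Fin.rev j), h⟩), by simp⟩
      · exact ⟨.inl i, by simp [h]⟩
      · exact ⟨.inr (.inr ⟨(Fin.rev j, i), h⟩), by simp⟩)

lemma mp_sq (k : ℕ) : MeasurePreserving (fun u : Fin k → Fin k → ℝ =>
    ((fun i => u i (Fin.rev i), (fun p => u p.1.1 (Fin.rev p.1.2), fun p => u p.1.2 (Fin.rev p.1.1))) :
      (Fin k → ℝ) × ((Tri k → ℝ) × (Tri k → ℝ)))) := by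
  have h1 := (mp_sum (sqEquiv k)).comp (mp_uncurry (ι := Fin k) (κ := Fin k))
  have h2 := (MeasurePreserving.id (volume : Measure (Fin k → ℝ))).prod (mp_sum (Equiv.refl (Tri k ⊕ Tri k)))
  exact h2.comp h1

lemma measurableSet_antitone (k : ℕ) : MeasurableSet {w : Fin k → ℝ | Antitone w} := by
  simp only [Antitone, Set.ofPred_forall]
  exact MeasurableSet.iInter fun i => MeasurableSet.iInter fun j => MeasurableSet.iInter fun _ =>
    measurableSet_le (by fun_prop) (by fun_prop)

def QQ (k : ℕ) : Set (Fin k → ℝ) := {w | ∀ i, w i ∈ Set.Icc (0:ℝ) 1}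

lemma QQ_meas (k : ℕ) : MeasurableSet (QQ k) := by
  simp only [QQ, Set.ofPred_forall]
  exact MeasurableSet.iInter fun i => (measurable_pi_apply i) measurableSet_Icc

lemma Ak_meas (k : ℕ) : MeasurableSet (Ak k) := by
  simp only [Ak, Antitone, Monotone, Set.ofPred_and, Set.ofPred_forall]
  refine MeasurableSet.inter ?_ ?_
  · exact MeasurableSet.iInter fun i => MeasurableSet.iInter fun j => MeasurableSet.iInter fun _ =>
      MeasurableSet.iInter fun _ => measurableSet_le (by fun_prop) (by fun_prop)
  · exact MeasurableSet.iInter fun i => MeasurableSet.iInter fun j => MeasurableSet.iInter fun _ =>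
      MeasurableSet.iInter fun _ => measurableSet_le (by fun_prop) (by fun_prop)

lemma QQ2_meas (k : ℕ) : MeasurableSet {u : Fin k → Fin k → ℝ | ∀ i j, u i j ∈ Set.Icc (0 : ℝ) 1} := by
  simp only [Set.ofPred_forall]
  exact MeasurableSet.iInter fun i => MeasurableSet.iInter fun j =>
    (show Measurable fun u : Fin k → Fin k → ℝ => u i j by fun_prop) measurableSet_Icc

/-- Step 1: integrate out the two triangles. -/
lemma step1 (k : ℕ) (F : (Fin k → ℝ) → ENNReal) (hF : Measurable F) :
    ∫⁻ u in {u : Fin k → Fin k → ℝ | ∀ i j, u i j ∈ Set.Icc (0 : ℝ) 1} ∩ Ak k, F (fun i => u i (Fin.rev i))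
      = ∫⁻ w in QQ k ∩ {w | Antitone w}, F w * ENNReal.ofReal ((DD w / GG k) ^ 2) := by
  rw [← lintegral_indicator ((QQ2_meas k).inter (Ak_meas k)),
    ← lintegral_indicator ((QQ_meas k).inter (measurableSet_antitone k))]
  let S : Set ((Fin k → ℝ) × ((Tri k → ℝ) × (Tri k → ℝ))) :=
    {p | p.1 ∈ QQ k} ∩ ({p | CC k p.1 p.2.1} ∩ {p | CC k p.1 p.2.2})
  have hS : MeasurableSet S := by
    refine (measurable_fst (QQ_meas k)).inter (MeasurableSet.inter ?_ ?_)
    · exact measurableSet_preimage (f := fun p : (Fin k → ℝ) × ((Tri k → ℝ) × (Tri k → ℝ)) => (p.1, p.2.1)) (by fun_prop) (CC_meas k)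
    · exact measurableSet_preimage (f := fun p : (Fin k → ℝ) × ((Tri k → ℝ) × (Tri k → ℝ)) => (p.1, p.2.2)) (by fun_prop) (CC_meas k)
  have hH : Measurable (S.indicator fun p => F p.1) := (hF.comp measurable_fst).indicator hS
  have h1 := (mp_sq k).lintegral_comp hH
  have h2 : ∀ u : Fin k → Fin k → ℝ, ({u : Fin k → Fin k → ℝ | ∀ i j, u i j ∈ Set.Icc (0 : ℝ) 1} ∩ Ak k).indicator (fun u => F (fun i => u i (Fin.rev i))) u
     = (S.indicator fun p => F p.1) (fun i => u i (Fin.rev i), (fun p => u p.1.1 (Fin.rev p.1.2), fun p => u p.1.2 (Fin.rev p.1.1))) := by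
    intro u
    classical
    simp only [Set.indicator_apply]
    congr 1
    exact propext (Ak_iff u)
  simp_rw [h2]
  rw [h1, Measure.volume_eq_prod, lintegral_prod _ hH.aemeasurable]
  congr 1
  ext w
  have h3 : ∀ y : (Tri k → ℝ) × (Tri k → ℝ), S.indicator (fun p => F p.1) (w, y)
      = F w * ((QQ k).indicator 1 w * ({x | CC k w x} ×ˢ {x | CC k w x}).indicator 1 y) := by
    intro y
    classical
    simp only [Set.indicator_apply, S, Set.mem_inter_iff, Set.mem_prod, Set.mem_ofPred_eq]
    by_cases a : w ∈ QQ k <;> by_cases b : CC k w y.1 <;> by_cases c : CC k w y.2 <;> simp [a, b, c]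
  have hm : MeasurableSet {x | CC k w x} := 
    measurableSet_preimage (f := fun x : Tri k → ℝ => (w, x)) (by fun_prop) (CC_meas k)
  simp_rw [h3]
  rw [lintegral_const_mul _ (by
      exact (measurable_const.indicator (hm.prod hm)).const_mul _),
    lintegral_const_mul _ (by exact (measurable_const.indicator (hm.prod hm))),
    lintegral_indicator_one (hm.prod hm), Measure.volume_eq_prod, Measure.prod_prod]
  by_cases hw : Antitone w
  · rw [CC_vol k w hw, ← ENNReal.ofReal_mul (div_nonneg (DD_nonneg hw) (GG_pos k).le), ← sq]
    by_cases hq : w ∈ QQ k <;> simp [Set.indicator_apply, hw, hq]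
  · have : {x | CC k w x} = ∅ := by
      ext x; simp only [Set.mem_ofPred_eq, Set.mem_empty_iff_false, iff_false]
      exact fun h => hw (CC_antitone h)
    simp [this, Set.indicator_apply, hw]

lemma DD_perm {k : ℕ} (w : Fin k → ℝ) (σ : Equiv.Perm (Fin k)) : DD (fun i => w (σ i)) ^ 2 = DD w ^ 2 := by
  have : (Matrix.vandermonde (fun i => - w (σ i))) = (Matrix.vandermonde (fun i => - w i)).submatrix σ id := rfl
  rw [DD, this, Matrix.det_permute, mul_pow, ← DD]
  rcases Int.units_eq_one_or (Equiv.Perm.sign σ) with h | h <;> simp [h]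

lemma DD_zero {k : ℕ} (w : Fin k → ℝ) (hw : ¬ Function.Injective w) : DD w = 0 := by
  by_contra h
  rw [DD, ← ne_eq, Matrix.det_vandermonde_ne_zero_iff] at h
  exact hw fun a b hab => h (by simpa using hab)

lemma card_anti {k : ℕ} (w : Fin k → ℝ) (hw : Function.Injective w) :
    ∃! σ : Equiv.Perm (Fin k), Antitone (fun i => w (σ i)) := by
  have key : ∀ σ : Equiv.Perm (Fin k), Antitone (fun i => w (σ i)) ↔ Monotone ((fun i => - w i) ∘ σ) := by
    intro σ
    constructor
    · intro h a b hab; simpa using h hab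
    · intro h a b hab; simpa using h hab
  refine ⟨Tuple.sort (fun i => - w i), (key _).2 (Tuple.monotone_sort _), fun τ hτ => ?_⟩
  have h := Tuple.unique_monotone ((key _).1 hτ) (Tuple.monotone_sort (fun i => - w i))
  ext i
  have := congrFun h i
  simp only [Function.comp, neg_inj] at this
  rw [hw this]

/-- Step 2: symmetrization. -/
lemma step2 (k : ℕ) (F : (Fin k → ℝ) → ENNReal) (hF : Measurable F)
    (hs : ∀ w (σ : Equiv.Perm (Fin k)), F (fun i => w (σ i)) = F w) :
    ∫⁻ w in QQ k, F w * ENNReal.ofReal ((DD w / GG k) ^ 2) =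
      k.factorial * ∫⁻ w in QQ k ∩ {w | Antitone w}, F w * ENNReal.ofReal ((DD w / GG k) ^ 2) := by
  classical
  have hmA := (QQ_meas k).inter (measurableSet_antitone k)
  rw [← lintegral_indicator hmA, ← lintegral_indicator (QQ_meas k)]
  set H : (Fin k → ℝ) → ENNReal := (QQ k ∩ {w | Antitone w}).indicator fun w => F w * ENNReal.ofReal ((DD w / GG k) ^ 2) with hH
  have hHm : Measurable H := by
    refine Measurable.indicator (hF.mul ?_) hmA
    exact ((continuous_DD.measurable.div_const _).pow_const 2).ennreal_ofReal
  have hp : ∀ w, (QQ k).indicator (fun w => F w * ENNReal.ofReal ((DD w / GG k) ^ 2)) w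
      = ∑ σ : Equiv.Perm (Fin k), H (fun i => w (σ i)) := by
    intro w
    have hq : ∀ σ : Equiv.Perm (Fin k), (fun i => w (σ i)) ∈ QQ k ↔ w ∈ QQ k := by
      intro σ
      exact ⟨fun h i => by simpa using h (σ.symm i), fun h i => h (σ i)⟩
    have h1 : ∀ σ : Equiv.Perm (Fin k), H (fun i => w (σ i)) =
        if Antitone (fun i => w (σ i)) then (QQ k).indicator (fun w => F w * ENNReal.ofReal ((DD w / GG k) ^ 2)) w else 0 := by
      intro σ
      simp only [hH, Set.indicator_apply, Set.mem_inter_iff, hq, Set.mem_ofPred_eq, hs, div_pow, DD_perm]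
      by_cases a : w ∈ QQ k <;> by_cases b : Antitone (fun i => w (σ i)) <;> simp [a, b]
    simp_rw [h1]
    by_cases hw : Function.Injective w
    · obtain ⟨σ, hσ, hu⟩ := card_anti w hw
      rw [Finset.sum_eq_single σ]
      · rw [if_pos hσ]
      · intro τ _ hτ
        rw [if_neg fun h => hτ (hu τ h)]
      · simp
    · have : (QQ k).indicator (fun w => F w * ENNReal.ofReal ((DD w / GG k) ^ 2)) w = 0 := by
        simp [Set.indicator_apply, DD_zero w hw]
      simp [this]
  simp_rw [hp]
  rw [lintegral_finsetSum]
  · have : ∀ σ : Equiv.Perm (Fin k), ∫⁻ w : Fin k → ℝ, H (fun i => w (σ i)) = ∫⁻ w, H w := fun σ =>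
      (mp_reindex σ).lintegral_comp hHm
    simp [this, Fintype.card_perm]
  · intro σ _
    exact hHm.comp (by fun_prop)

lemma DD_sq {k : ℕ} (w : Fin k → ℝ) :
    ∏ p ∈ Finset.univ.filter (fun p : Fin k × Fin k => p.1 < p.2), (w p.1 - w p.2) ^ 2 = DD w ^ 2 := by
  rw [DD_eq, Finset.prod_pow, Finset.prod_sigma']
  congr 1
  refine Finset.prod_bij' (fun p _ => ⟨p.1, p.2⟩) (fun p _ => (p.1, p.2)) ?_ ?_ ?_ ?_ ?_ <;> simp

theorem integral_over_Ak (k : ℕ) (hk : 1 ≤ k) (f : ℝ → ℝ)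
    (hmeas : Measurable f) (hbdd : ∃ M : ℝ, ∀ x, |f x| ≤ M) :
    (∫ u in {u : Fin k → Fin k → ℝ | ∀ i j, u i j ∈ Set.Icc (0 : ℝ) 1},
        f (∑ i, u i (Fin.rev i)) * Set.indicator (Ak k) (fun _ => (1 : ℝ)) u)
      = (1 / ((k.factorial : ℝ) * (∏ i ∈ Finset.range k, (i.factorial : ℝ)) ^ 2)) *
          ∫ w in {w : Fin k → ℝ | ∀ i, w i ∈ Set.Icc (0 : ℝ) 1},
            f (∑ i, w i) *
              ∏ p ∈ Finset.univ.filter (fun p : Fin k × Fin k => p.1 < p.2),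
                (w p.1 - w p.2) ^ 2 := by
  have hD : Measurable fun w : Fin k → ℝ => ENNReal.ofReal ((DD w / GG k) ^ 2) :=
    ((continuous_DD.measurable.div_const _).pow_const 2).ennreal_ofReal
  let s1 : (Fin k → Fin k → ℝ) → ℝ := fun u => ∑ i, u i (Fin.rev i)
  have hs1 : Measurable s1 := by fun_prop
  let s2 : (Fin k → ℝ) → ℝ := fun w => ∑ i, w i
  have hs2 : Measurable s2 := by fun_prop
  let μ1 : Measure ℝ := (volume.restrict ({u : Fin k → Fin k → ℝ | ∀ i j, u i j ∈ Set.Icc (0 : ℝ) 1} ∩ Ak k)).map s1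
  let μ2 : Measure ℝ := ((volume.restrict (QQ k)).withDensity fun w => ENNReal.ofReal ((DD w / GG k) ^ 2)).map s2
  have hμ : μ2 = (k.factorial : ENNReal) • μ1 := by
    refine Measure.ext_of_lintegral _ fun g hg => ?_
    rw [lintegral_smul_measure, lintegral_map hg hs1, lintegral_map hg hs2,
      lintegral_withDensity_eq_lintegral_mul _ hD (show Measurable fun w => g (s2 w) from hg.comp hs2)]
    have e1 := step1 k (fun w => g (∑ i, w i)) (hg.comp hs2)
    have e2 := step2 k (fun w => g (∑ i, w i)) (hg.comp hs2) (fun w σ => by rw [Equiv.sum_comp σ w])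
    rw [← e1] at e2
    rw [smul_eq_mul, ← e2]
    refine lintegral_congr fun w => ?_
    simp [mul_comm, s2]
  have hI : ∫ x, f x ∂μ2 = k.factorial * ∫ x, f x ∂μ1 := by
    rw [hμ, integral_smul_measure]; simp
  have hI1 : ∫ x, f x ∂μ1 = ∫ u in {u : Fin k → Fin k → ℝ | ∀ i j, u i j ∈ Set.Icc (0 : ℝ) 1},
        f (∑ i, u i (Fin.rev i)) * Set.indicator (Ak k) (fun _ => (1 : ℝ)) u := by
    rw [integral_map hs1.aemeasurable hmeas.aestronglyMeasurable, Set.inter_comm,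
      ← Measure.restrict_restrict (Ak_meas k), ← integral_indicator (Ak_meas k)]
    refine integral_congr_ae (Filter.Eventually.of_forall fun u => ?_)
    by_cases hu : u ∈ Ak k <;> simp [hu, s1]
  have hI2 : ∫ x, f x ∂μ2 = (1 / GG k ^ 2) * ∫ w in QQ k, f (∑ i, w i) * DD w ^ 2 := by
    rw [integral_map hs2.aemeasurable hmeas.aestronglyMeasurable,
      integral_withDensity_eq_integral_toReal_smul hD (Filter.Eventually.of_forall fun _ => ENNReal.ofReal_lt_top),
      ← integral_const_mul]
    refine integral_congr_ae (Filter.Eventually.of_forall fun w => ?_)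
    simp only [ENNReal.toReal_ofReal (sq_nonneg _), smul_eq_mul, s2]
    ring
  simp_rw [DD_sq]
  rw [← hI1]
  change _ = 1 / ((k.factorial : ℝ) * GG k ^ 2) * ∫ w in QQ k, f (∑ i, w i) * DD w ^ 2
  have hk0 : (k.factorial : ℝ) ≠ 0 := by positivity
  have hG := (GG_pos k).ne'
  rw [hI2] at hI
  rw [one_div, mul_inv, mul_assoc, ← one_div (GG k ^ 2), hI, inv_mul_cancel_left₀ hk0]
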